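/- arXiv:1711.05358 — 2 statements merged into one kernel-verified Lean document; each statement's English description precedes it below -/
import Mathlib

section
/- Let p be an odd prime, let n ≥ 0, and let Q_1, …, Q_r be quadratic forms on the vector space F_p^n. Then the number of common isotropic vectors, i.e. the cardinality of the set X = {x ∈ F_p^n : Q_1(x) = ⋯ = Q_r(x) = 0}, satisfies |X| ≥ (1 − p^{−1/2}) · p^{n − 2r(r+1)}. -/
open Matrix

/-- **Chevalley's theorem** for quadratic forms: `r` quadratic forms in more than `2 * r`
variables over a finite field have a nontrivial common zero. -/
theorem exists_ne_zero_common_isotropic {K ι σ : Type*} [Field K] [Fintype K] [DecidableEq K]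
    [Fintype ι] [Fintype σ] [DecidableEq σ] (N : ι → Matrix σ σ K)
    (h : 2 * Fintype.card ι < Fintype.card σ) :
    ∃ y : σ → K, y ≠ 0 ∧ ∀ i, y ⬝ᵥ (N i).mulVec y = 0 := by
  let f : ι → MvPolynomial σ K := fun i ↦
    ∑ a, ∑ b, MvPolynomial.C (N i a b) * (MvPolynomial.X a * MvPolynomial.X b)
  have hf (i : ι) (y : σ → K) : MvPolynomial.eval y (f i) = y ⬝ᵥ (N i).mulVec y := by
    simp only [f, map_sum, map_mul, MvPolynomial.eval_C, MvPolynomial.eval_X, dotProduct, mulVec,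
      Finset.mul_sum]
    exact Finset.sum_congr rfl fun _ _ ↦ Finset.sum_congr rfl fun _ _ ↦ by ring
  have hdeg (i : ι) : (f i).totalDegree ≤ 2 := by
    refine MvPolynomial.totalDegree_finsetSum_le fun a _ ↦
      MvPolynomial.totalDegree_finsetSum_le fun b _ ↦ ?_
    refine (MvPolynomial.totalDegree_mul _ _).trans ?_
    have := MvPolynomial.totalDegree_mul (MvPolynomial.X a : MvPolynomial σ K) (MvPolynomial.X b)
    simp only [MvPolynomial.totalDegree_X, MvPolynomial.totalDegree_C] at this ⊢
    omega
  have hsum : ∑ i, (f i).totalDegree < Fintype.card σ :=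
    (Finset.sum_le_card_nsmul Finset.univ _ 2 fun i _ ↦ hdeg i).trans_lt (by
      simpa [mul_comm] using h)
  have hdvd := char_dvd_card_solutions_of_fintype_sum_lt (ringChar K) hsum
  have hone : 1 < Fintype.card {y : σ → K // ∀ i, MvPolynomial.eval y (f i) = 0} :=
    (CharP.char_is_prime K (ringChar K)).one_lt.trans_le
      (Nat.le_of_dvd (Fintype.card_pos_iff.2 ⟨⟨0, fun i ↦ by rw [hf, zero_dotProduct]⟩⟩) hdvd)
  obtain ⟨y, hy⟩ := Fintype.exists_ne_of_one_lt_card hone ⟨0, fun i ↦ by rw [hf, zero_dotProduct]⟩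
  exact ⟨y, fun h0 ↦ hy (Subtype.ext h0), fun i ↦ by rw [← hf]; exact y.2 i⟩

/-- A subspace without nonzero common isotropic vectors of `r` quadratic forms over a finite field
has dimension at most `2 * r`. -/
theorem finrank_le_of_anisotropic {K ι m : Type*} [Field K] [Fintype K] [Fintype ι] [Fintype m]
    (M : ι → Matrix m m K) (W : Submodule K (m → K))
    (hW : ∀ x ∈ W, (∀ i, x ⬝ᵥ (M i).mulVec x = 0) → x = 0) :
    Module.finrank K W ≤ 2 * Fintype.card ι := by
  classical
  by_contra! hlt
  let e := (Module.finBasis K W).equivFun.symm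
  let B := LinearMap.toMatrix' (W.subtype ∘ₗ e.toLinearMap)
  have hB (y : Fin (Module.finrank K W) → K) : B *ᵥ y = e y := LinearMap.toMatrix'_mulVec _ y
  obtain ⟨y, hy0, hy⟩ := exists_ne_zero_common_isotropic (fun i ↦ Bᵀ * M i * B) (by simpa using hlt)
  refine hy0 (e.map_eq_zero_iff.1 (Subtype.ext (hW _ (e y).2 fun i ↦ ?_)))
  rw [← hB, ← hy i, ← mulVec_mulVec, ← mulVec_mulVec, dotProduct_mulVec y, vecMul_transpose]

/-- Warning's bound for quadratic forms: `r` quadratic forms on a vector space `V` over a finite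
field `K` have at least `|V| / |K| ^ (2 * r)` common zeros. -/
theorem card_le_ncard_common_isotropic_mul {K ι m : Type*} [Field K] [Fintype K] [Fintype ι]
    [Fintype m] (M : ι → Matrix m m K) :
    Fintype.card K ^ Fintype.card m ≤
      {x : m → K | ∀ i, x ⬝ᵥ (M i).mulVec x = 0}.ncard *
        Fintype.card K ^ (2 * Fintype.card ι) := by
  classical
  set X := {x : m → K | ∀ i, x ⬝ᵥ (M i).mulVec x = 0}
  obtain ⟨W, hW⟩ := (Set.toFinite {W : Submodule K (m → K) | ∀ x ∈ W, x ∈ X → x = 0}).exists_maximal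
    ⟨⊥, fun x hx _ ↦ by simpa using hx⟩
  have hcover : Function.Surjective fun q : X × W ↦ (q.1 + q.2 : m → K) := by
    intro v
    by_cases hv : v ∈ W
    · exact ⟨(⟨0, fun i ↦ by simp⟩, ⟨v, hv⟩), by simp⟩
    have hnot : W ⊔ K ∙ v ∉ {W : Submodule K (m → K) | ∀ x ∈ W, x ∈ X → x = 0} := fun h ↦
      hv (hW.2 h le_sup_left (Submodule.mem_sup_right (Submodule.mem_span_singleton_self v)))
    simp only [Set.mem_ofPred_eq, not_forall] at hnot
    obtain ⟨x, hx, hxX, hx0⟩ := hnot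
    obtain ⟨w, hw, u, hu, rfl⟩ := Submodule.mem_sup.1 hx
    obtain ⟨c, rfl⟩ := Submodule.mem_span_singleton.1 hu
    have hc : c ≠ 0 := by
      rintro rfl
      rw [zero_smul, add_zero] at hxX hx0
      exact hx0 (hW.1 w hw hxX)
    refine ⟨(⟨c⁻¹ • (w + c • v), fun i ↦ ?_⟩, ⟨-(c⁻¹ • w), W.neg_mem (W.smul_mem _ hw)⟩), ?_⟩
    · rw [mulVec_smul, smul_dotProduct, dotProduct_smul, hxX i, smul_zero, smul_zero]
    · simp [smul_add, smul_smul, hc]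
  calc Fintype.card K ^ Fintype.card m = Nat.card (m → K) := by simp
    _ ≤ Nat.card (X × W) := Nat.card_le_card_of_surjective _ hcover
    _ = X.ncard * Fintype.card K ^ Module.finrank K W := by
      rw [Nat.card_prod, Nat.card_coe_set_eq, Module.natCard_eq_pow_finrank (K := K) (V := W),
        Nat.card_eq_fintype_card]
    _ ≤ _ := Nat.mul_le_mul_left _ (Nat.pow_le_pow_right Fintype.card_pos
      (finrank_le_of_anisotropic M W fun x hx h ↦ hW.1 x hx h))

open Matrix

/-- Let `p` be an odd prime, `n ≥ 0`, and `Q_1, …, Q_r` quadratic forms on `F_p^n`,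
given by symmetric matrices `M 1, …, M r`. Then the number of common isotropic vectors
is at least `(1 - p^{-1/2}) p^{n - 2r(r+1)}`. -/
theorem common_isotropic_vectors_count (p : ℕ) (hp : p.Prime) (hp2 : p ≠ 2) (n r : ℕ)
    (M : Fin r → Matrix (Fin n) (Fin n) (ZMod p)) (hM : ∀ i, (M i)ᵀ = M i) :
    (1 - (p : ℝ) ^ (-(1 / 2) : ℝ)) * (p : ℝ) ^ ((n : ℝ) - 2 * r * (r + 1)) ≤
      ({x : Fin n → ZMod p | ∀ i, x ⬝ᵥ (M i).mulVec x = 0}.ncard : ℝ) := by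
  have := Fact.mk hp
  have hp1 : (1 : ℝ) ≤ p := by exact_mod_cast hp.one_lt.le
  have hp0 : (0 : ℝ) < p := by linarith
  have hcard : (p : ℝ) ^ n ≤
      ({x : Fin n → ZMod p | ∀ i, x ⬝ᵥ (M i).mulVec x = 0}.ncard : ℝ) * (p : ℝ) ^ (2 * r) := by
    have := card_le_ncard_common_isotropic_mul M
    simp only [ZMod.card, Fintype.card_fin] at this
    exact_mod_cast this
  calc (1 - (p : ℝ) ^ (-(1 / 2) : ℝ)) * (p : ℝ) ^ ((n : ℝ) - 2 * r * (r + 1))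
      ≤ 1 * (p : ℝ) ^ ((n : ℝ) - (2 * r : ℕ)) := by
        gcongr
        · linarith [Real.rpow_nonneg hp0.le (-(1 / 2))]
        · push_cast
          nlinarith [Nat.cast_nonneg (α := ℝ) r]
    _ = (p : ℝ) ^ n / (p : ℝ) ^ (2 * r) := by
        rw [one_mul, Real.rpow_sub hp0, Real.rpow_natCast, Real.rpow_natCast]
    _ ≤ _ := (div_le_iff₀ (by positivity)).2 hcard
end

section
/- Let F_q be a finite field with q elements and let n ≥ 1. Then ∑_{f monic in F_q[t], deg f = n} τ(f)² ≤ 4 n³ q^n, where τ(f) denotes the number of monic divisors of f. Equivalently, the average of τ(f)² over the q^n monic polynomials of degree n is at most 4n³. -/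
open Polynomial

/-- The number of monic divisors of a polynomial `f ∈ F_q[t]`. -/
noncomputable def polyTau {F : Type*} [Field F] (f : Polynomial F) : ℕ :=
  {d : Polynomial F | d.Monic ∧ d ∣ f}.ncard

/-- The monic polynomial of degree `n` whose lower coefficient vector is `x ∈ F_q^n`. -/
noncomputable def monicPoly (F : Type*) [Field F] (n : ℕ) (x : Fin n → F) : Polynomial F :=
  X ^ n + ∑ i : Fin n, C (x i) * X ^ (i : ℕ)

section MonicPoly

variable {F : Type*} [Field F]

theorem monicPoly_natDegree_coeff {f : F[X]} (hf : f.Monic) :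
    monicPoly F f.natDegree (fun i => f.coeff i) = f := by
  conv_rhs => rw [hf.as_sum]
  rw [monicPoly, Finset.sum_range]

theorem degree_sum_C_mul_X_pow_lt {n : ℕ} (x : Fin n → F) :
    (∑ i : Fin n, C (x i) * X ^ (i : ℕ)).degree < (n : WithBot ℕ) := by
  rw [← mem_degreeLT]
  refine Submodule.sum_mem _ fun i _ => mem_degreeLT.2 ?_
  exact (degree_C_mul_X_pow_le _ _).trans_lt (by exact_mod_cast i.2)

theorem monicPoly_monic (n : ℕ) (x : Fin n → F) : (monicPoly F n x).Monic :=
  monic_X_pow_add (degree_sum_C_mul_X_pow_lt x)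

theorem monicPoly_natDegree (n : ℕ) (x : Fin n → F) : (monicPoly F n x).natDegree = n := by
  rw [monicPoly, natDegree_add_eq_left_of_degree_lt, natDegree_X_pow]
  rw [degree_X_pow]
  exact degree_sum_C_mul_X_pow_lt x

theorem monicPoly_coeff (n : ℕ) (x : Fin n → F) (i : Fin n) :
    (monicPoly F n x).coeff i = x i := by
  have h : ∀ j : Fin n, ((i : ℕ) = j) ↔ i = j := fun j => Fin.ext_iff.symm
  simp [monicPoly, coeff_X_pow, i.2.ne, h]

/-- Two monic divisors `d₁`, `d₂` of a monic `f` can be written as `g a` and `g b` with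
`f = g a b e`. -/
theorem exists_monic_factorization_of_dvd {f d₁ d₂ : F[X]} (hf : f.Monic) (h₁ : d₁.Monic)
    (h₂ : d₂.Monic) (hd₁ : d₁ ∣ f) (hd₂ : d₂ ∣ f) :
    ∃ g a b e : F[X], g.Monic ∧ a.Monic ∧ b.Monic ∧ e.Monic ∧
      d₁ = g * a ∧ d₂ = g * b ∧ f = g * a * b * e := by
  classical
  set g₀ := EuclideanDomain.gcd d₁ d₂ with hg₀
  have hne : g₀ ≠ 0 := fun h => h₁.ne_zero (EuclideanDomain.gcd_eq_zero_iff.1 h).1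
  set u : F[X] := C g₀.leadingCoeff⁻¹
  set g := g₀ * u with hg
  have hgm : g.Monic := monic_mul_leadingCoeff_inv hne
  have hu : IsUnit u :=
    isUnit_C.2 (isUnit_iff_ne_zero.2 (inv_ne_zero (leadingCoeff_ne_zero.2 hne)))
  obtain ⟨a, ha⟩ : g ∣ d₁ := (hu.mul_right_dvd).2 (EuclideanDomain.gcd_dvd_left _ _)
  obtain ⟨b, hb⟩ : g ∣ d₂ := (hu.mul_right_dvd).2 (EuclideanDomain.gcd_dvd_right _ _)
  have hab : IsCoprime b a := by
    refine ⟨EuclideanDomain.gcdB d₁ d₂ * u, EuclideanDomain.gcdA d₁ d₂ * u, ?_⟩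
    apply mul_left_cancel₀ hgm.ne_zero
    have := EuclideanDomain.gcd_eq_gcd_ab d₁ d₂
    linear_combination (-u) * this -
      EuclideanDomain.gcdB d₁ d₂ * u * hb - EuclideanDomain.gcdA d₁ d₂ * u * ha
  obtain ⟨c, hc⟩ := hd₁
  have hbc : b ∣ c := by
    refine hab.dvd_of_dvd_mul_left ((mul_dvd_mul_iff_left hgm.ne_zero).1 ?_)
    rwa [← hb, ← mul_assoc, ← ha, ← hc]
  obtain ⟨e, he⟩ := hbc
  have hf' : f = g * a * b * e := by rw [hc, ha, he]; ring
  have ham : a.Monic := hgm.of_mul_monic_left (ha ▸ h₁)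
  have hbm : b.Monic := hgm.of_mul_monic_left (hb ▸ h₂)
  exact ⟨g, a, b, e, hgm, ham, hbm,
    ((hgm.mul ham).mul hbm).of_mul_monic_left (hf' ▸ hf), ha, hb, hf'⟩

end MonicPoly

theorem card_antidiagonalTuple (k n : ℕ) :
    (Finset.Nat.antidiagonalTuple k n).card = k.multichoose n := by
  rw [← Sym.card_sym_fin_eq_multichoose, ← Nat.card_eq_fintype_card,
    Nat.card_congr (Sym.equivNatSumOfFintype (Fin k) n)]
  exact (Nat.subtype_card _ fun x => Finset.Nat.mem_antidiagonalTuple).symm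

theorem multichoose_four_le {n : ℕ} (hn : 1 ≤ n) : Nat.multichoose 4 n ≤ 4 * n ^ 3 := by
  have h : Nat.multichoose 4 n = (n + 3).choose 3 := by
    rw [Nat.multichoose_eq, show 4 + n - 1 = n + 3 by omega, Nat.choose_symm_add]
  have h' := Nat.descFactorial_eq_factorial_mul_choose (n + 3) 3
  have h3 : (n + 3) * ((n + 2) * (n + 1)) ≤ (4 * n) * ((3 * n) * (2 * n)) := by
    gcongr <;> omega
  simp only [Nat.succ_descFactorial_succ, Nat.descFactorial_zero, Nat.factorial] at h'
  rw [h]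
  nlinarith

section Quadruples

variable {F : Type*} [Field F]

/-- The monic polynomial with lower coefficients `p.2 i`, of degree `p.1 i`. -/
noncomputable def monicEntry {k : ℕ} (p : Σ t : Fin k → ℕ, ∀ i, Fin (t i) → F) (i : Fin k) :
    F[X] :=
  monicPoly F (p.1 i) (p.2 i)

theorem exists_monicEntry_eq {k : ℕ} {v : Fin k → F[X]} (hv : ∀ i, (v i).Monic) :
    ∃ p : Σ t : Fin k → ℕ, ∀ i, Fin (t i) → F,
      p.1 = (fun i => (v i).natDegree) ∧ monicEntry p = v :=
  ⟨⟨fun i => (v i).natDegree, fun i j => (v i).coeff j⟩, rfl,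
    funext fun i => monicPoly_natDegree_coeff (hv i)⟩

variable [Fintype F]

/-- The `k`-tuples of monic polynomials whose degrees sum to `n`. -/
def monicTuples (F : Type*) [Fintype F] (k n : ℕ) :
    Finset (Σ t : Fin k → ℕ, ∀ i, Fin (t i) → F) := by
  classical
  exact (Finset.Nat.antidiagonalTuple k n).sigma fun _ => Finset.univ

theorem card_monicTuples (F : Type*) [Fintype F] (k n : ℕ) :
    (monicTuples F k n).card = k.multichoose n * Fintype.card F ^ n := by
  classical
  rw [monicTuples, Finset.card_sigma, ← card_antidiagonalTuple, ← smul_eq_mul,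
    ← Finset.sum_const]
  refine Finset.sum_congr rfl fun t ht => ?_
  rw [Finset.Nat.mem_antidiagonalTuple] at ht
  simp [Fintype.card_pi, Finset.prod_pow_eq_pow_sum, ht]

open Classical in
theorem polyTau_sq_le_card (n : ℕ) (x : Fin n → F) :
    polyTau (monicPoly F n x) ^ 2 ≤
      ((monicTuples F 4 n).filter
        fun p => (fun i : Fin n => (∏ j, monicEntry p j).coeff i) = x).card := by
  rw [polyTau, sq, ← Set.ncard_prod, ← Set.ncard_coe_finset]
  refine (Set.ncard_le_ncard ?_ ((Finset.finite_toSet _).image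
    fun p => (monicEntry p 0 * monicEntry p 1, monicEntry p 0 * monicEntry p 2))).trans
    (Set.ncard_image_le (Finset.finite_toSet _))
  rintro ⟨d₁, d₂⟩ ⟨⟨h₁, hd₁⟩, h₂, hd₂⟩
  obtain ⟨g, a, b, e, hg, ha, hb, he, rfl, rfl, hf⟩ :=
    exists_monic_factorization_of_dvd (monicPoly_monic n x) h₁ h₂ hd₁ hd₂
  obtain ⟨p, hp, hpv⟩ := exists_monicEntry_eq (v := ![g, a, b, e])
    (by simp [Fin.forall_fin_succ, *])
  refine ⟨p, ?_, by simp [hpv]⟩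
  have hdeg : g.natDegree + a.natDegree + b.natDegree + e.natDegree = n := by
    rw [← monicPoly_natDegree n x, hf, ((hg.mul ha).mul hb).natDegree_mul he,
      (hg.mul ha).natDegree_mul hb, hg.natDegree_mul ha]
  rw [Finset.mem_coe, Finset.mem_filter]
  constructor
  · simp [monicTuples, Finset.Nat.mem_antidiagonalTuple, hp, Fin.sum_univ_four, hdeg]
  · funext i
    rw [← monicPoly_coeff n x i, hf, hpv]
    simp [Fin.prod_univ_four]

end Quadruples

/-- For a finite field `F_q` and `n ≥ 1`, the sum of `τ(f)²` over the monic polynomials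
of degree `n` is at most `4 n³ qⁿ`. -/
theorem sum_tau_sq_le {F : Type*} [Field F] [Fintype F] (q : ℕ) (hq : Fintype.card F = q)
    (n : ℕ) (hn : 1 ≤ n) :
    ∑ x : Fin n → F, polyTau (monicPoly F n x) ^ 2 ≤ 4 * n ^ 3 * q ^ n := by
  classical
  calc ∑ x : Fin n → F, polyTau (monicPoly F n x) ^ 2
      ≤ (monicTuples F 4 n).card := by
        rw [Finset.card_eq_sum_card_fiberwise (t := Finset.univ)
          (f := fun p => fun i : Fin n => (∏ j, monicEntry p j).coeff i)
          fun _ _ => Finset.mem_coe.2 (Finset.mem_univ _)]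
        refine Finset.sum_le_sum fun x _ => ?_
        convert polyTau_sq_le_card n x
    _ = Nat.multichoose 4 n * q ^ n := by rw [card_monicTuples, hq]
    _ ≤ 4 * n ^ 3 * q ^ n := Nat.mul_le_mul_right _ (multichoose_four_le hn)
end
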